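/- Fix (θ, β) ∈ (0,1)² and α > 0 such that α < η^clu_θ(β). Then as p → ∞: (i) if 0 < β < (1−θ)/2, then Hamm_p(ℓ̂_*^{(sa)}) → 0; (ii) if (1−θ)/2 < β < 1 and N = ⌈pε_p⌉, then Hamm_p(ℓ̂_N^{(sa)}) → 0. -/

import Mathlib

open MeasureTheory ProbabilityTheory Filter
open scoped ENNReal NNReal Classical BigOperators

namespace ARWPaper

/-- `n = ⌈p^θ⌉`. -/
noncomputable def nDim (p : ℕ) (θ : ℝ) : ℕ := ⌈(p : ℝ) ^ θ⌉₊

/-- Law of a single class label: uniform on `{-1, 1}`. -/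
noncomputable def signLaw : Measure ℝ :=
  (1 / 2 : ℝ≥0∞) • Measure.dirac (1 : ℝ) + (1 / 2 : ℝ≥0∞) • Measure.dirac (-1 : ℝ)

/-- Law of a single coordinate of `μ`: `τ` w.p. `ε`, `0` w.p. `1 - ε`. -/
noncomputable def muLaw (ε τ : ℝ) : Measure ℝ :=
  ENNReal.ofReal (1 - ε) • Measure.dirac (0 : ℝ) + ENNReal.ofReal ε • Measure.dirac τ

/-- Standard Gaussian product measure on `ℝ^n`. -/
noncomputable def gaussPi (n : ℕ) : Measure (Fin n → ℝ) :=
  Measure.pi fun _ => gaussianReal 0 1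

/-- Law of the noise matrix `Z` (i.i.d. `N(0,1)` entries, rows indexed by `Fin n`). -/
noncomputable def noiseLaw (n p : ℕ) : Measure (Fin n → Fin p → ℝ) :=
  Measure.pi fun _ => gaussPi p

/-- Sample space for `(ℓ, μ, Z)`. -/
abbrev Omega (n p : ℕ) := (Fin n → ℝ) × (Fin p → ℝ) × (Fin n → Fin p → ℝ)

/-- Joint law of `(ℓ, μ, Z)`. -/
noncomputable def jointLaw (n p : ℕ) (ε τ : ℝ) : Measure (Omega n p) :=
  (Measure.pi fun _ : Fin n => signLaw).prod
    ((Measure.pi fun _ : Fin p => muLaw ε τ).prod (noiseLaw n p))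

/-- Data matrix `X = ℓ μ' + Z`. -/
def dataMap {n p : ℕ} (ω : Omega n p) : Fin n → Fin p → ℝ :=
  fun i j => ω.1 i * ω.2.1 j + ω.2.2 i j

/-- Hamming clustering error of a clustering procedure `ell`, where the observed data
matrix is `D ω`. -/
noncomputable def hammingClu (n p : ℕ) (ε τ : ℝ)
    (D : Omega n p → Fin n → Fin p → ℝ)
    (ell : (Fin n → Fin p → ℝ) → Fin n → ℝ) : ℝ :=
  (n : ℝ)⁻¹ * min
    (∑ i : Fin n, ((jointLaw n p ε τ) {ω | ell (D ω) i ≠ ω.1 i}).toReal)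
    (∑ i : Fin n, ((jointLaw n p ε τ) {ω | ell (D ω) i ≠ -ω.1 i}).toReal)

/-- Hamming error for signal (support) recovery. -/
noncomputable def hammingSig (n p : ℕ) (ε τ : ℝ)
    (D : Omega n p → Fin n → Fin p → ℝ)
    (S : (Fin n → Fin p → ℝ) → Finset (Fin p)) : ℝ :=
  ((p : ℝ) * ε)⁻¹ * ∑ j : Fin p,
    (((jointLaw n p ε τ) {ω | ω.2.1 j = 0 ∧ j ∈ S (D ω)}).toReal +
      ((jointLaw n p ε τ) {ω | ω.2.1 j ≠ 0 ∧ j ∉ S (D ω)}).toReal)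

/-- Sum of type I and type II testing errors of the rejection region `R`. -/
noncomputable def testErr (n p : ℕ) (ε τ : ℝ)
    (R : Set (Fin n → Fin p → ℝ)) : ℝ :=
  ((noiseLaw n p) R).toReal + ((jointLaw n p ε τ) {ω | dataMap ω ∉ R}).toReal

/-- Statistical boundary for clustering. -/
noncomputable def etaClu (θ β : ℝ) : ℝ :=
  if β < (1 - θ) / 2 then (1 - 2 * β) / 2
  else if β < 1 - θ then θ / 2
  else (1 - β) / 2

/-- CTUB boundary for clustering. -/
noncomputable def etaCluT (θ β : ℝ) : ℝ :=
  if β < (1 - θ) / 2 then (1 - 2 * β) / 2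
  else if β < 1 / 2 then (1 + θ - 2 * β) / 4
  else if β < 1 - θ / 2 then θ / 4
  else (1 - β) / 2

/-- Statistical boundary for signal recovery. -/
noncomputable def etaSig (θ β : ℝ) : ℝ :=
  if β < 1 - θ then θ / 2 else (1 + θ - β) / 4

/-- CTUB boundary for signal recovery. -/
noncomputable def etaSigT (θ β : ℝ) : ℝ :=
  if β < (1 - θ) / 2 then θ / 2
  else if β < 1 / 2 then (1 + θ - 2 * β) / 4
  else θ / 4

noncomputable def etaHyp1 (θ β : ℝ) : ℝ := (2 + θ - 4 * β) / 4
noncomputable def etaHyp2 (θ β : ℝ) : ℝ := min (θ / 2) ((1 + θ - β) / 4)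
noncomputable def etaHyp (θ β : ℝ) : ℝ := max (etaHyp1 θ β) (etaHyp2 θ β)
noncomputable def etaHypT (θ β : ℝ) : ℝ := max (etaHyp1 θ β) (θ / 4)

/-- Standard phase function `ρ*`. -/
noncomputable def rhoStar (b : ℝ) : ℝ :=
  if b < 3 / 4 then b - 1 / 2 else (1 - Real.sqrt (1 - b)) ^ 2

/-- Phase function for IF-PCA. -/
noncomputable def rhoStarTheta (θ β : ℝ) : ℝ :=
  (1 - θ) * rhoStar (1 / 2 + (β - 1 / 2) / (1 - θ))

/-- Euclidean norm of a vector. -/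
noncomputable def l2 {n : ℕ} (v : Fin n → ℝ) : ℝ := Real.sqrt (∑ i, v i ^ 2)

/-- Entrywise sup-norm of a vector. -/
noncomputable def linf {n : ℕ} (v : Fin n → ℝ) : ℝ := ⨆ i, |v i|

/-- `cos(x, y) = |⟨x/‖x‖, y/‖y‖⟩|`. -/
noncomputable def cosv {n : ℕ} (x y : Fin n → ℝ) : ℝ :=
  |∑ i, x i * y i| / (l2 x * l2 y)

/-- Spectral (operator) norm of a matrix. -/
noncomputable def specNorm {m k : ℕ} (A : Matrix (Fin m) (Fin k) ℝ) : ℝ :=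
  sSup ((fun v => l2 (A.mulVec v)) '' {v | l2 v ≤ 1})

/-- Simple Aggregation clustering: entrywise sign of the sum of all columns. -/
noncomputable def ellSimpleAgg {n p : ℕ} (X : Fin n → Fin p → ℝ) : Fin n → ℝ :=
  fun i => Real.sign (∑ j, X i j)

/-- `S` picks, for every data matrix, a size-`N` subset maximizing `‖∑_{j ∈ S} x_j‖₁`. -/
def IsSparseAggMaximizer {n p : ℕ} (N : ℕ)
    (S : (Fin n → Fin p → ℝ) → Finset (Fin p)) : Prop :=
  ∀ X, (S X).card = N ∧
    ∀ T : Finset (Fin p), T.card = N →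
      ∑ i, |∑ j ∈ T, X i j| ≤ ∑ i, |∑ j ∈ S X, X i j|

/-- Sparse Aggregation clustering. -/
noncomputable def ellSparseAgg {n p : ℕ}
    (S : (Fin n → Fin p → ℝ) → Finset (Fin p)) (X : Fin n → Fin p → ℝ) :
    Fin n → ℝ :=
  fun i => Real.sign (∑ j ∈ S X, X i j)

/-- Gram matrix `X X'`. -/
def gram {n p : ℕ} (X : Fin n → Fin p → ℝ) : Matrix (Fin n) (Fin n) ℝ :=
  Matrix.of fun i i' => ∑ j, X i j * X i' j

/-- `ξ` is a unit eigenvector of `A` associated with its largest eigenvalue. -/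
def IsTopEigenvector {n : ℕ} (A : Matrix (Fin n) (Fin n) ℝ) (ξ : Fin n → ℝ) : Prop :=
  (∑ i, ξ i ^ 2) = 1 ∧
    ∃ lam : ℝ, A.mulVec ξ = lam • ξ ∧
      ∀ (lam' : ℝ) (v : Fin n → ℝ), v ≠ 0 → A.mulVec v = lam' • v → lam' ≤ lam

/-- χ²-screening: the set of selected features. -/
noncomputable def chiSel {n p : ℕ} (q : ℝ) (X : Fin n → Fin p → ℝ) : Finset (Fin p) :=
  Finset.univ.filter fun j =>
    Real.sqrt (2 * q * Real.log p) ≤ ((∑ i, X i j ^ 2) - n) / Real.sqrt (2 * n)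

/-- Post-selection Gram matrix `X^{(q)} (X^{(q)})'`. -/
noncomputable def gramSel {n p : ℕ} (q : ℝ) (X : Fin n → Fin p → ℝ) :
    Matrix (Fin n) (Fin n) ℝ :=
  Matrix.of fun i i' => ∑ j ∈ chiSel q X, X i j * X i' j

/-- IF-PCA calibration `τ_p* = p^{-θ/4} (4 r log p)^{1/4}`. -/
noncomputable def tauStar (p : ℕ) (θ r : ℝ) : ℝ :=
  (p : ℝ) ^ (-(θ / 4)) * (4 * r * Real.log p) ^ ((1 : ℝ) / 4)

/-- The ideal threshold `q*` of IF-PCA in the Region of Possibility. -/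
noncomputable def qStar (θ β r : ℝ) : ℝ :=
  if (β - θ / 2) / 3 < r then (β - θ / 2 + r) ^ 2 / (4 * r) else 4 * r

/-- Support of `μ`. -/
noncomputable def suppSet {p : ℕ} (μ : Fin p → ℝ) : Finset (Fin p) :=
  Finset.univ.filter fun j => μ j ≠ 0

/-- The event `D_p`: `| |S(μ)| - p ε_p | ≤ √(6 p ε_p log p)` with `ε_p = p^{-β}`. -/
def inDp (β : ℝ) {p : ℕ} (μ : Fin p → ℝ) : Prop :=
  |((suppSet μ).card : ℝ) - (p : ℝ) * (p : ℝ) ^ (-β)| ≤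
    Real.sqrt (6 * ((p : ℝ) * (p : ℝ) ^ (-β)) * Real.log p)

/-- Selection threshold `n + 2√(q n log p)` for the squared column norm. -/
noncomputable def thresh (p n : ℕ) (q : ℝ) : ℝ :=
  (n : ℝ) + 2 * Real.sqrt (q * n * Real.log p)

/-- `π₀ = P(‖z‖² > n + 2√(q n log p))`, `z ~ N(0, I_n)`. -/
noncomputable def pi0 (p n : ℕ) (q : ℝ) : ℝ :=
  ((gaussPi n) {z | thresh p n q < ∑ i, z i ^ 2}).toReal

/-- `π₁ = P(‖z + τ ℓ‖² > n + 2√(q n log p))`, `z ~ N(0, I_n)`. -/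
noncomputable def pi1 (p : ℕ) {n : ℕ} (q τ : ℝ) (ℓ : Fin n → ℝ) : ℝ :=
  ((gaussPi n) {z | thresh p n q < ∑ i, (z i + τ * ℓ i) ^ 2}).toReal

/-- Expected number of selected useless features (`s = |S(μ)|`). -/
noncomputable def m0q (p n : ℕ) (q : ℝ) (s : ℕ) : ℝ := ((p : ℝ) - s) * pi0 p n q

/-- Expected number of selected useful features. -/
noncomputable def m1q (p : ℕ) {n : ℕ} (q τ : ℝ) (ℓ : Fin n → ℝ) (s : ℕ) : ℝ :=
  (s : ℝ) * pi1 p q τ ℓ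

/-- `m^{(q)}`. -/
noncomputable def mq (p : ℕ) {n : ℕ} (q τ : ℝ) (ℓ : Fin n → ℝ) (s : ℕ) : ℝ :=
  m0q p n q s + m1q p q τ ℓ s

/-- `m_*^{(q)}`. -/
noncomputable def mstarq (p : ℕ) {n : ℕ} (q τ : ℝ) (ℓ : Fin n → ℝ) (s : ℕ) : ℝ :=
  ((p : ℝ) - s) * (n : ℝ)⁻¹ *
      (∫ z in {z : Fin n → ℝ | thresh p n q < ∑ i, z i ^ 2}, (∑ i, z i ^ 2) ∂gaussPi n) +
    (s : ℝ) * (n : ℝ)⁻¹ *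
      (∫ z in {z : Fin n → ℝ | thresh p n q < ∑ i, (z i + τ * ℓ i) ^ 2},
        (∑ i, z i ^ 2) ∂gaussPi n)

/-- The threshold `q̃(β, θ, r)` separating the "fat" and "skinny" cases. -/
noncomputable def qTilde (β θ r : ℝ) : ℝ :=
  if β < 1 - θ then max (1 - θ) ((Real.sqrt (1 - β - θ) + Real.sqrt r) ^ 2)
  else 1 - θ

/-- The set of features selected by χ²-screening, in terms of `(ℓ, μ, Z)`. -/
noncomputable def selSet {n p : ℕ} (q : ℝ) (ℓ : Fin n → ℝ) (μ : Fin p → ℝ)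
    (Z : Fin n → Fin p → ℝ) : Finset (Fin p) :=
  chiSel q fun i j => ℓ i * μ j + Z i j

/-- `Z^{(q)} (Z^{(q)})'`. -/
noncomputable def gramZq {n p : ℕ} (q : ℝ) (ℓ : Fin n → ℝ) (μ : Fin p → ℝ)
    (Z : Fin n → Fin p → ℝ) : Matrix (Fin n) (Fin n) ℝ :=
  Matrix.of fun i i' => ∑ j ∈ selSet q ℓ μ Z, Z i j * Z i' j

/-- `X^{(q)} (X^{(q)})'`. -/
noncomputable def gramXq {n p : ℕ} (q : ℝ) (ℓ : Fin n → ℝ) (μ : Fin p → ℝ)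
    (Z : Fin n → Fin p → ℝ) : Matrix (Fin n) (Fin n) ℝ :=
  Matrix.of fun i i' =>
    ∑ j ∈ selSet q ℓ μ Z, (ℓ i * μ j + Z i j) * (ℓ i' * μ j + Z i' j)

/-- The matrix `ℓ (μ^{(q)})' (Z^{(q)})' + Z^{(q)} μ^{(q)} ℓ'`. -/
noncomputable def crossMat {n p : ℕ} (q : ℝ) (ℓ : Fin n → ℝ) (μ : Fin p → ℝ)
    (Z : Fin n → Fin p → ℝ) : Matrix (Fin n) (Fin n) ℝ :=
  Matrix.of fun i i' =>
    ℓ i * (∑ j ∈ selSet q ℓ μ Z, Z i' j * μ j) +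
      (∑ j ∈ selSet q ℓ μ Z, Z i j * μ j) * ℓ i'

/-- Colored-noise data matrix `X = ℓ μ' + A Z B`. -/
noncomputable def dataColored {n p : ℕ} (A : Matrix (Fin n) (Fin n) ℝ)
    (B : Matrix (Fin p) (Fin p) ℝ) (ω : Omega n p) : Fin n → Fin p → ℝ :=
  fun i j => ω.1 i * ω.2.1 j + (A * Matrix.of ω.2.2 * B) i j

/-- Colored-noise data matrix `X = ℓ μ' + Z B`. -/
noncomputable def dataColoredB {n p : ℕ} (B : Matrix (Fin p) (Fin p) ℝ)
    (ω : Omega n p) : Fin n → Fin p → ℝ :=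
  fun i j => ω.1 i * ω.2.1 j + (Matrix.of ω.2.2 * B) i j

/-- `y_*^{(sa)} = n^{-1/2} X' ℓ̂_*^{(sa)}`. -/
noncomputable def ySA {n p : ℕ} (X : Fin n → Fin p → ℝ) : Fin p → ℝ :=
  fun j => (Real.sqrt n)⁻¹ * ∑ i, X i j * ellSimpleAgg X i

/-- `Ŝ_*^{(sa)}`: thresholding `y_*^{(sa)}` at the universal threshold. -/
noncomputable def ShatSA {n p : ℕ} (X : Fin n → Fin p → ℝ) : Finset (Fin p) :=
  Finset.univ.filter fun j => Real.sqrt (2 * Real.log p) ≤ |ySA X j|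

/-- `y_*^{(if)} = n^{-1/2} X' sgn(ξ)` for a given vector `ξ`. -/
noncomputable def yIF {n p : ℕ} (ξ : Fin n → ℝ) (X : Fin n → Fin p → ℝ) : Fin p → ℝ :=
  fun j => (Real.sqrt n)⁻¹ * ∑ i, X i j * Real.sign (ξ i)

/-- `Ŝ_*^{(if)}`: thresholding `y_*^{(if)}` at the universal threshold. -/
noncomputable def ShatIF {n p : ℕ} (ξ : Fin n → ℝ) (X : Fin n → Fin p → ℝ) : Finset (Fin p) :=
  Finset.univ.filter fun j => Real.sqrt (2 * Real.log p) ≤ |yIF ξ X j|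

/-- Rejection region of the Simple Aggregation test `T̂_*^{(sa)}`. -/
noncomputable def rejSA {n p : ℕ} : Set (Fin n → Fin p → ℝ) :=
  {X | 2 * Real.sqrt (2 * Real.log p) ≤
    ((p : ℝ) * (∑ i, ((p : ℝ)⁻¹ * ∑ j, X i j) ^ 2) - n) / Real.sqrt (2 * n)}

/-- Rejection region of the Sparse Aggregation test `T̂_N^{(sa)}`. -/
noncomputable def rejSparse {n p : ℕ} (N : ℕ)
    (S : (Fin n → Fin p → ℝ) → Finset (Fin p)) : Set (Fin n → Fin p → ℝ) :=
  {X | Real.sqrt (2 / Real.pi) * n + Real.sqrt (2 * n * (N + 2) * Real.log p) ≤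
    (Real.sqrt N)⁻¹ * ∑ i, |∑ j ∈ S X, X i j|}

/-- χ² P-value of feature `j`. -/
noncomputable def pvalue {n p : ℕ} (X : Fin n → Fin p → ℝ) (j : Fin p) : ℝ :=
  ((gaussPi n) {z | (∑ i, X i j ^ 2) ≤ ∑ i, z i ^ 2}).toReal

/-- Higher Criticism statistic. -/
noncomputable def HCstat {n p : ℕ} (X : Fin n → Fin p → ℝ) : ℝ :=
  sSup {h : ℝ | ∃ i : Fin p, 2 * (i.val + 1) ≤ p ∧
    h = Real.sqrt p * (((i.val : ℝ) + 1) / p - pvalue X (Tuple.sort (pvalue X) i)) /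
      Real.sqrt (pvalue X (Tuple.sort (pvalue X) i) *
        (1 - pvalue X (Tuple.sort (pvalue X) i)))}

/-- Rejection region of the Higher Criticism test. -/
noncomputable def rejHC {n p : ℕ} : Set (Fin n → Fin p → ℝ) :=
  {X | 2 * Real.sqrt (2 * Real.log (Real.log p)) ≤ HCstat X}

/-- Lebesgue measure on the space of `n × p` matrices. -/
noncomputable def lebPi (n p : ℕ) : Measure (Fin n → Fin p → ℝ) :=
  Measure.pi fun _ : Fin n => Measure.pi fun _ : Fin p => (volume : Measure ℝ)

/-- Law of `X` in Experiment 1 (`X = ℓ μ' + c_p Z`) with `ℓ_i` forced to be `s`. -/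
noncomputable def condLaw1 (n p : ℕ) (ε τ cp : ℝ) (i : Fin n) (s : ℝ) :
    Measure (Fin n → Fin p → ℝ) :=
  (jointLaw n p ε τ).map fun ω => fun i' j =>
    Function.update ω.1 i s i' * ω.2.1 j + cp * ω.2.2 i' j

/-- Law of `X` in Experiment 2 (`X = ℓ μ' + c_p Z + W`) with `ℓ_i` forced to be `s`,
where `W ~ ν` is independent of `(ℓ, μ, Z)`. -/
noncomputable def condLaw2 (n p : ℕ) (ε τ cp : ℝ)
    (ν : Measure (Fin n → Fin p → ℝ)) (i : Fin n) (s : ℝ) :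
    Measure (Fin n → Fin p → ℝ) :=
  ((jointLaw n p ε τ).prod ν).map fun ωw => fun i' j =>
    Function.update ωw.1.1 i s i' * ωw.1.2.1 j + cp * ωw.1.2.2 i' j + ωw.2 i' j

end ARWPaper

namespace ARWPaper

/-- A sum of independent centred Gaussian coordinates is centred Gaussian, with the variances
adding up. -/
lemma map_sum_pi_gaussianReal {ι : Type*} [Fintype ι] {Ω : ι → Type*}
    [∀ i, MeasurableSpace (Ω i)] {μ : (i : ι) → Measure (Ω i)} [∀ i, IsProbabilityMeasure (μ i)]
    {X : (i : ι) → Ω i → ℝ} {v : ι → ℝ≥0} (hm : ∀ i, Measurable (X i))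
    (hX : ∀ i, (μ i).map (X i) = gaussianReal 0 (v i)) :
    (Measure.pi μ).map (fun ω => ∑ i, X i (ω i)) = gaussianReal 0 (∑ i, v i) := by
  have hev : ∀ i, (Measure.pi μ).map (fun ω => X i (ω i)) = gaussianReal 0 (v i) := by
    intro i
    rw [← hX i, ← (measurePreserving_eval μ i).map_eq,
      Measure.map_map (hm i) (measurable_pi_apply i)]
    rfl
  have hG : ∀ i, HasGaussianLaw (fun ω => X i (ω i)) (Measure.pi μ) := fun i =>
    ⟨by rw [hev i]; infer_instance⟩
  have hG' : ∀ i, HasGaussianLaw (X i) (μ i) := fun i => ⟨by rw [hX i]; infer_instance⟩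
  have hS := (iIndepFun.hasGaussianLaw hG
    (iIndepFun_pi (fun i => (hm i).aemeasurable))).fun_sum
  have hmean : ∀ i, ∫ ω, X i (ω i) ∂(Measure.pi μ) = 0 := by
    intro i
    have := integral_map (μ := Measure.pi μ) (φ := fun ω => X i (ω i)) (f := fun x : ℝ => x)
      ((hm i).comp (measurable_pi_apply i)).aemeasurable (by fun_prop)
    rw [← this, hev i, integral_id_gaussianReal]
  have hvar : ∀ i, Var[X i; μ i] = v i := by
    intro i
    have := variance_map (μ := μ i) (X := fun x : ℝ => x) (Y := X i) (by fun_prop)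
      (hm i).aemeasurable
    rw [hX i] at this
    rw [show X i = (fun x : ℝ => x) ∘ X i from rfl, ← this, variance_fun_id_gaussianReal]
  rw [hS.map_eq_gaussianReal]
  congr 1
  · rw [integral_finsetSum _ fun i _ => (hG i).integrable]
    exact Finset.sum_eq_zero fun i _ => hmean i
  · have h := variance_sum_pi (μ := μ) (X := X) (fun i => (hG' i).memLp_two)
    have e : (fun ω : (i : ι) → Ω i => ∑ i, X i (ω i)) = ∑ i, fun ω => X i (ω i) := by
      ext ω; simp
    rw [e, h]
    simp only [hvar]
    rw [← NNReal.coe_sum, Real.toNNReal_coe]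

instance (n : ℕ) : IsProbabilityMeasure (gaussPi n) := by
  unfold gaussPi; infer_instance

instance (n p : ℕ) : IsProbabilityMeasure (noiseLaw n p) := by
  unfold noiseLaw; infer_instance

lemma map_linear_noiseLaw {n p : ℕ} (a : Fin n → Fin p → ℝ) :
    (noiseLaw n p).map (fun Z => ∑ i, ∑ j, a i j * Z i j) =
      gaussianReal 0 (∑ i, ∑ j, (a i j ^ 2).toNNReal) := by
  refine map_sum_pi_gaussianReal (X := fun i (z : Fin p → ℝ) => ∑ j, a i j * z j) (fun i => by fun_prop)
    fun i => ?_
  refine map_sum_pi_gaussianReal (X := fun j (z : ℝ) => a i j * z) (fun j => by fun_prop) fun j => ?_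
  rw [gaussianReal_map_const_mul]
  simp [Real.toNNReal_of_nonneg (sq_nonneg (a i j))]

lemma noiseLaw_linear_tail {n p : ℕ} (a : Fin n → Fin p → ℝ) {t V : ℝ} (ht : 0 ≤ t) (hV : 0 < V)
    (ha : ∑ i, ∑ j, a i j ^ 2 = V) :
    (noiseLaw n p).real {Z | t ≤ ∑ i, ∑ j, a i j * Z i j} ≤ Real.exp (-(t ^ 2 / (2 * V))) := by
  have hl := map_linear_noiseLaw a
  have hv : ((∑ i, ∑ j, (a i j ^ 2).toNNReal : ℝ≥0) : ℝ) = V := by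
    push_cast
    rw [← ha]
    exact Finset.sum_congr rfl fun i _ => Finset.sum_congr rfl fun j _ =>
      Real.coe_toNNReal _ (sq_nonneg _)
  have hm := mgf_gaussianReal hl (t / V)
  have hint : Integrable (fun Z : Fin n → Fin p → ℝ =>
      Real.exp (t / V * ∑ i, ∑ j, a i j * Z i j)) (noiseLaw n p) := by
    have h := integrable_exp_mul_gaussianReal (μ := 0)
      (v := ∑ i, ∑ j, (a i j ^ 2).toNNReal) (t / V)
    rw [← hl] at h
    exact h.comp_measurable (by fun_prop)
  refine (measure_ge_le_exp_mul_mgf t (by positivity : 0 ≤ t / V) hint).trans ?_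
  rw [hm, hv, ← Real.exp_add]
  refine Real.exp_le_exp.2 (le_of_eq ?_)
  field_simp
  ring

lemma noiseLaw_linear_eq_null {n p : ℕ} (a : Fin n → Fin p → ℝ) (c : ℝ) {i₀ : Fin n} {j₀ : Fin p}
    (ha : a i₀ j₀ ≠ 0) : noiseLaw n p {Z | ∑ i, ∑ j, a i j * Z i j = c} = 0 := by
  have hv : (∑ i, ∑ j, (a i j ^ 2).toNNReal) ≠ 0 := by
    refine ne_of_gt (lt_of_lt_of_le (b := (a i₀ j₀ ^ 2).toNNReal) ?_ ?_)
    · rw [Real.toNNReal_pos]; positivity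
    · exact (Finset.single_le_sum (f := fun j => (a i₀ j ^ 2).toNNReal) (fun _ _ => zero_le)
        (Finset.mem_univ j₀)).trans
        (Finset.single_le_sum (f := fun i => ∑ j, (a i j ^ 2).toNNReal) (fun _ _ => zero_le)
        (Finset.mem_univ i₀))
  have := nullSingletonClass_gaussianReal (μ := 0) hv
  have h := measure_singleton (μ := gaussianReal 0 (∑ i, ∑ j, (a i j ^ 2).toNNReal)) c
  rw [← map_linear_noiseLaw a, Measure.map_apply (by fun_prop) (measurableSet_singleton c)] at h
  exact h

instance : IsProbabilityMeasure signLaw := by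
  refine ⟨?_⟩
  simp [signLaw, ENNReal.inv_two_add_inv_two]

lemma isProbabilityMeasure_muLaw {ε : ℝ} (τ : ℝ) (h0 : 0 ≤ ε) (h1 : ε ≤ 1) :
    IsProbabilityMeasure (muLaw ε τ) := by
  refine ⟨?_⟩
  simp [muLaw, ← ENNReal.ofReal_add (sub_nonneg.2 h1) h0]

lemma ae_signLaw : ∀ᵐ x ∂signLaw, x = 1 ∨ x = -1 := by
  simp [signLaw, ae_add_measure_iff, ae_dirac_eq]

lemma ae_muLaw (ε τ : ℝ) : ∀ᵐ x ∂(muLaw ε τ), x = 0 ∨ x = τ := by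
  rw [muLaw, ae_add_measure_iff]
  constructor <;>
  · refine Measure.ae_smul_measure ?_ _
    simp [ae_dirac_eq]

lemma ae_pi_signLaw (n : ℕ) :
    ∀ᵐ ℓ ∂(Measure.pi fun _ : Fin n => signLaw), ∀ i, ℓ i = 1 ∨ ℓ i = -1 :=
  ae_all_iff.2 fun i =>
    (Measure.quasiMeasurePreserving_eval (fun _ : Fin n => signLaw) i).ae ae_signLaw

lemma ae_pi_muLaw (p : ℕ) {ε : ℝ} (τ : ℝ) (h0 : 0 ≤ ε) (h1 : ε ≤ 1) :
    ∀ᵐ m ∂(Measure.pi fun _ : Fin p => muLaw ε τ), ∀ j, m j = 0 ∨ m j = τ :=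
  have := isProbabilityMeasure_muLaw τ h0 h1
  ae_all_iff.2 fun j =>
    (Measure.quasiMeasurePreserving_eval (fun _ : Fin p => muLaw ε τ) j).ae (ae_muLaw ε τ)

lemma integral_muLaw {ε : ℝ} (τ : ℝ) (h0 : 0 ≤ ε) (h1 : ε ≤ 1) (f : ℝ → ℝ) :
    ∫ x, f x ∂(muLaw ε τ) = (1 - ε) * f 0 + ε * f τ := by
  rw [muLaw, integral_add_measure]
  · simp [integral_smul_measure, ENNReal.toReal_ofReal h0, ENNReal.toReal_ofReal (sub_nonneg.2 h1)]
  · exact (integrable_dirac (by simp)).smul_measure ENNReal.ofReal_ne_top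
  · exact (integrable_dirac (by simp)).smul_measure ENNReal.ofReal_ne_top

lemma memLp_muLaw {ε : ℝ} (τ : ℝ) (h0 : 0 ≤ ε) (h1 : ε ≤ 1) :
    MemLp (fun x : ℝ => x) 2 (muLaw ε τ) := by
  have := isProbabilityMeasure_muLaw τ h0 h1
  refine MemLp.of_bound (by fun_prop) |τ| ?_
  filter_upwards [ae_muLaw ε τ] with x hx
  rcases hx with rfl | rfl <;> simp

lemma variance_muLaw_le {ε : ℝ} (τ : ℝ) (h0 : 0 ≤ ε) (h1 : ε ≤ 1) :
    Var[fun x : ℝ => x; muLaw ε τ] ≤ ε * τ ^ 2 := by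
  have := isProbabilityMeasure_muLaw τ h0 h1
  refine (variance_le_expectation_sq (by fun_prop)).trans (le_of_eq ?_)
  have := integral_muLaw τ h0 h1 (fun x => x ^ 2)
  simpa using this

/-- The total signal concentrates from below around its mean. -/
lemma pi_muLaw_sum_le {p : ℕ} {ε τ δ : ℝ} (hp : 0 < p) (h0 : 0 < ε) (h1 : ε ≤ 1) (hτ : 0 < τ)
    (hδ : 0 < δ) :
    (Measure.pi fun _ : Fin p => muLaw ε τ).real {m | ∑ j, m j ≤ (1 - δ) * (p * ε * τ)} ≤
      1 / (δ ^ 2 * (p * ε)) := by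
  have := isProbabilityMeasure_muLaw τ h0.le h1
  set P := Measure.pi fun _ : Fin p => muLaw ε τ with hP
  have hp' : (0 : ℝ) < p := by exact_mod_cast hp
  have hL : ∀ j, MemLp (fun m : Fin p → ℝ => m j) 2 P := fun j =>
    (memLp_muLaw τ h0.le h1).comp_measurePreserving
      (measurePreserving_eval (fun _ : Fin p => muLaw ε τ) j)
  have hS : MemLp (fun m : Fin p → ℝ => ∑ j, m j) 2 P := memLp_finsetSum _ fun j _ => hL j
  have hmean : ∫ m, ∑ j, m j ∂P = p * ε * τ := by
    rw [integral_finsetSum _ fun j _ => (hL j).integrable (by norm_num)]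
    have : ∀ j, ∫ m, m j ∂P = ε * τ := by
      intro j
      have h := (measurePreserving_eval (fun _ : Fin p => muLaw ε τ) j).map_eq
      have h2 := integral_map (μ := P) (φ := fun m => m j) (f := fun x : ℝ => x)
        (measurable_pi_apply j).aemeasurable (by fun_prop)
      rw [← h2]
      change ∫ y, y ∂(P.map (Function.eval j)) = _
      rw [h, integral_muLaw τ h0.le h1 (fun x => x)]
      ring
    simp [this]
    ring
  have hvar : Var[fun m : Fin p → ℝ => ∑ j, m j; P] ≤ p * (ε * τ ^ 2) := by
    have h := variance_sum_pi (μ := fun _ : Fin p => muLaw ε τ) (X := fun _ (x : ℝ) => x)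
      (fun _ => memLp_muLaw τ h0.le h1)
    have e : (fun m : Fin p → ℝ => ∑ j, m j) = ∑ j, fun m : Fin p → ℝ => m j := by
      ext m; simp
    rw [e, h]
    refine (Finset.sum_le_sum fun j _ => variance_muLaw_le τ h0.le h1).trans ?_
    simp
  have hc := meas_ge_le_variance_div_sq hS (c := δ * (p * ε * τ)) (by positivity)
  rw [hmean] at hc
  have hsub : {m : Fin p → ℝ | ∑ j, m j ≤ (1 - δ) * (p * ε * τ)} ⊆
      {m | δ * (p * ε * τ) ≤ |∑ j, m j - p * ε * τ|} := by
    intro m hm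
    simp only [Set.mem_ofPred_eq] at hm ⊢
    rw [le_abs]
    right
    linarith
  have h3 := ENNReal.toReal_mono ENNReal.ofReal_ne_top ((measure_mono hsub).trans hc)
  rw [ENNReal.toReal_ofReal (div_nonneg (variance_nonneg _ _) (by positivity))] at h3
  refine h3.trans ((div_le_div_of_nonneg_right hvar (by positivity)).trans (le_of_eq ?_))
  field_simp

/-- If at most `r` of the finitely many events `C i` occur together on `G`, then their
probabilities sum to at most `r` plus a multiple of the probability of the complement of `G`. -/
lemma sum_measureReal_le_of_card_le {Ω : Type*} [MeasurableSpace Ω] {P : Measure Ω}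
    [IsProbabilityMeasure P] {n : ℕ} {C : Fin n → Set Ω} (hC : ∀ i, MeasurableSet (C i))
    {G : Set Ω} {r : ℝ} (hr : 0 ≤ r)
    (h : ∀ ω ∈ G, ((Finset.univ.filter fun i => ω ∈ C i).card : ℝ) ≤ r) :
    ∑ i, P.real (C i) ≤ r + n * P.real Gᶜ := by
  have hpt : ∀ ω, ∑ i, (C i).indicator (fun _ => (1 : ℝ≥0∞)) ω ≤
      ENNReal.ofReal r + (Gᶜ).indicator (fun _ => (n : ℝ≥0∞)) ω := by
    intro ω
    have e : ∑ i, (C i).indicator (fun _ => (1 : ℝ≥0∞)) ω =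
        ((Finset.univ.filter fun i => ω ∈ C i).card : ℝ≥0∞) := by
      simp [Set.indicator_apply]
    rw [e]
    by_cases hω : ω ∈ G
    · have h2 := ENNReal.ofReal_le_ofReal (h ω hω)
      rw [ENNReal.ofReal_natCast] at h2
      exact h2.trans le_self_add
    · rw [Set.indicator_of_mem (by simpa using hω)]
      refine le_trans ?_ le_add_self
      exact_mod_cast (Finset.card_le_univ _).trans (by simp)
  have hle : ∑ i, P (C i) ≤ ENNReal.ofReal r + n * P Gᶜ := by
    calc ∑ i, P (C i) = ∫⁻ ω, ∑ i, (C i).indicator (fun _ => (1 : ℝ≥0∞)) ω ∂P := by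
          rw [lintegral_finsetSum _ fun i _ => measurable_const.indicator (hC i)]
          simp [lintegral_indicator_const (hC _)]
      _ ≤ ∫⁻ ω, (ENNReal.ofReal r + (Gᶜ).indicator (fun _ => (n : ℝ≥0∞)) ω) ∂P :=
          lintegral_mono hpt
      _ ≤ _ := by
          rw [lintegral_add_left measurable_const]
          simp only [lintegral_const, measure_univ, mul_one]
          gcongr
          exact lintegral_indicator_const_le _ _
  have hfin : ENNReal.ofReal r + n * P Gᶜ ≠ ∞ := by finiteness
  have := ENNReal.toReal_mono hfin hle
  rw [ENNReal.toReal_sum (fun i _ => measure_ne_top _ _),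
    ENNReal.toReal_add ENNReal.ofReal_ne_top (by finiteness), ENNReal.toReal_ofReal hr,
    ENNReal.toReal_mul, ENNReal.toReal_natCast] at this
  exact this

lemma sign_mul_add_eq {l m z : ℝ} (hl : l = 1 ∨ l = -1) (hz : |z| < m) :
    Real.sign (l * m + z) = l := by
  obtain ⟨h1, h2⟩ := abs_lt.1 hz
  rcases hl with rfl | rfl
  · exact Real.sign_of_pos (by linarith)
  · exact Real.sign_of_neg (by linarith)

/-- Deterministic core of Sparse Aggregation: when the noise is uniformly small compared to the
signal, a maximizing column set clusters all but a small fraction of the rows correctly. -/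
lemma card_misclustered_le {n p N : ℕ} {ρ τ : ℝ} {ℓ : Fin n → ℝ} {m : Fin p → ℝ}
    {Z : Fin n → Fin p → ℝ} (hn : 0 < n) (hN : 0 < N) (hNp : N ≤ p) (hτ : 0 < τ) (hρ0 : 0 < ρ)
    (hρ : ρ ≤ 1 / 6) (hℓ : ∀ i, ℓ i = 1 ∨ ℓ i = -1) (hm : ∀ j, m j = 0 ∨ m j = τ)
    (hsum : (1 - ρ) * (N * τ) ≤ ∑ j, m j)
    (hZ : ∀ S : Finset (Fin p), S.card = N → ∀ v : Fin n → ℝ, (∀ i, v i = 1 ∨ v i = -1) →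
      ∑ i, v i * ∑ j ∈ S, Z i j ≤ ρ * (n * N * τ))
    {T : Finset (Fin p)} (hT : T.card = N)
    (hmax : ∀ S : Finset (Fin p), S.card = N →
      ∑ i, |∑ j ∈ S, (ℓ i * m j + Z i j)| ≤ ∑ i, |∑ j ∈ T, (ℓ i * m j + Z i j)|) :
    ((Finset.univ.filter fun i =>
      Real.sign (∑ j ∈ T, (ℓ i * m j + Z i j)) ≠ ℓ i).card : ℝ) ≤ 2 * ρ * n := by
  have hm0 : ∀ j, 0 ≤ m j := fun j => by rcases hm j with h | h <;> rw [h]; exact hτ.le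
  have hn' : (0 : ℝ) < n := by exact_mod_cast hn
  have hN' : (0 : ℝ) < N := by exact_mod_cast hN
  have hNτ : 0 < N * τ := by positivity
  have hsplit : ∀ (S : Finset (Fin p)) i,
      ∑ j ∈ S, (ℓ i * m j + Z i j) = ℓ i * ∑ j ∈ S, m j + ∑ j ∈ S, Z i j := by
    intro S i
    rw [Finset.sum_add_distrib, Finset.mul_sum]
  have hℓabs : ∀ i, |ℓ i| = 1 := fun i => by rcases hℓ i with h | h <;> simp [h]
  have hℓsq : ∀ i, ℓ i * ℓ i = 1 := fun i => by rcases hℓ i with h | h <;> simp [h]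
  obtain ⟨S, hS, hSm⟩ : ∃ S : Finset (Fin p), S.card = N ∧ (1 - ρ) * (N * τ) ≤ ∑ j ∈ S, m j := by
    set A := Finset.univ.filter fun j => m j = τ with hA
    rcases le_total N A.card with h | h
    · obtain ⟨S, hSA, hS⟩ := Finset.exists_subset_card_eq h
      refine ⟨S, hS, ?_⟩
      rw [Finset.sum_congr rfl fun j hj => (Finset.mem_filter.1 (hSA hj)).2]
      simp only [Finset.sum_const, hS, nsmul_eq_mul]
      nlinarith
    · obtain ⟨S, hAS, hS⟩ := Finset.exists_superset_card_eq h (by simpa using hNp)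
      refine ⟨S, hS, hsum.trans (le_of_eq ?_)⟩
      symm
      refine Finset.sum_subset (Finset.subset_univ S) fun j _ hj => (hm j).resolve_right ?_
      intro h
      exact hj (hAS (by simp [hA, h]))
  have hlow : n * ((1 - ρ) * (N * τ)) - ρ * (n * N * τ) ≤
      ∑ i, |∑ j ∈ S, (ℓ i * m j + Z i j)| := by
    have h1 := hZ S hS (fun i => -ℓ i) (fun i => by
      rcases hℓ i with h | h <;> simp [h])
    have h2 : ∀ i, ∑ j ∈ S, m j - (-ℓ i) * ∑ j ∈ S, Z i j ≤
        |∑ j ∈ S, (ℓ i * m j + Z i j)| := by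
      intro i
      have h3 := le_abs_self (ℓ i * ∑ j ∈ S, (ℓ i * m j + Z i j))
      rw [abs_mul, hℓabs, one_mul] at h3
      refine le_trans (le_of_eq ?_) h3
      rw [hsplit, mul_add, ← mul_assoc, hℓsq]
      ring
    have h4 := Finset.sum_le_sum fun i (_ : i ∈ Finset.univ) => h2 i
    rw [Finset.sum_sub_distrib] at h4
    simp only [Finset.sum_const, Finset.card_univ, Fintype.card_fin, nsmul_eq_mul] at h4
    have h5 := mul_le_mul_of_nonneg_left hSm hn'.le
    linarith
  have hnoise : ∑ i, |∑ j ∈ T, Z i j| ≤ ρ * (n * N * τ) := by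
    have h1 := hZ T hT (fun i => if 0 ≤ ∑ j ∈ T, Z i j then 1 else -1) (fun i => by
      split_ifs <;> simp)
    refine le_trans (le_of_eq (Finset.sum_congr rfl fun i _ => ?_)) h1
    split_ifs with h
    · rw [abs_of_nonneg h, one_mul]
    · rw [abs_of_neg (not_le.1 h)]; ring
  have hup : ∑ i, |∑ j ∈ T, (ℓ i * m j + Z i j)| ≤ n * ∑ j ∈ T, m j + ρ * (n * N * τ) := by
    have h2 : ∀ i, |∑ j ∈ T, (ℓ i * m j + Z i j)| ≤ ∑ j ∈ T, m j + |∑ j ∈ T, Z i j| := by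
      intro i
      rw [hsplit]
      refine (abs_add_le _ _).trans ?_
      rw [abs_mul, hℓabs, one_mul, abs_of_nonneg (Finset.sum_nonneg fun j _ => hm0 j)]
    have h4 := Finset.sum_le_sum fun i (_ : i ∈ Finset.univ) => h2 i
    rw [Finset.sum_add_distrib] at h4
    simp only [Finset.sum_const, Finset.card_univ, Fintype.card_fin, nsmul_eq_mul] at h4
    linarith
  have hmT : N * τ / 2 ≤ ∑ j ∈ T, m j := by
    have h := (hlow.trans (hmax S hS)).trans hup
    have h2 : n * ((1 - 3 * ρ) * (N * τ)) ≤ n * ∑ j ∈ T, m j := by linarith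
    have h3 := le_of_mul_le_mul_left h2 hn'
    nlinarith
  set B := Finset.univ.filter fun i => Real.sign (∑ j ∈ T, (ℓ i * m j + Z i j)) ≠ ℓ i with hB
  have hbad : ∀ i ∈ B, N * τ / 2 ≤ |∑ j ∈ T, Z i j| := by
    intro i hi
    by_contra! hlt
    refine (Finset.mem_filter.1 hi).2 ?_
    rw [hsplit]
    exact sign_mul_add_eq (hℓ i) (hlt.trans_le hmT)
  have h1 : B.card * (N * τ / 2) ≤ ρ * (n * N * τ) := by
    have := Finset.card_nsmul_le_sum B _ _ hbad
    rw [nsmul_eq_mul] at this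
    exact (this.trans (Finset.sum_le_sum_of_subset_of_nonneg (Finset.subset_univ B)
      fun _ _ _ => abs_nonneg _)).trans hnoise
  have h2 : (B.card : ℝ) * (N * τ) ≤ (2 * ρ * n) * (N * τ) := by linarith
  exact le_of_mul_le_mul_right h2 hNτ

lemma isProbabilityMeasure_jointLaw (n p : ℕ) {ε : ℝ} (τ : ℝ) (h0 : 0 ≤ ε) (h1 : ε ≤ 1) :
    IsProbabilityMeasure (jointLaw n p ε τ) := by
  have := isProbabilityMeasure_muLaw τ h0 h1
  unfold jointLaw
  infer_instance

/-- Union bound under the joint law, after discarding the null set where the labels or the signal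
take unexpected values. -/
lemma jointLaw_real_le {n p : ℕ} {ε τ : ℝ} (h0 : 0 ≤ ε) (h1 : ε ≤ 1) {B : Set (Omega n p)}
    {A : Set (Fin p → ℝ)} {D : Set (Fin n → Fin p → ℝ)}
    (h : ∀ ω ∈ B, (∀ i, ω.1 i = 1 ∨ ω.1 i = -1) → (∀ j, ω.2.1 j = 0 ∨ ω.2.1 j = τ) →
      ω.2.1 ∈ A ∨ ω.2.2 ∈ D) :
    (jointLaw n p ε τ).real B ≤
      (Measure.pi fun _ : Fin p => muLaw ε τ).real A + (noiseLaw n p).real D := by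
  have := isProbabilityMeasure_muLaw τ h0 h1
  have := isProbabilityMeasure_jointLaw n p τ h0 h1
  have hsnd : (jointLaw n p ε τ).map Prod.snd =
      (Measure.pi fun _ : Fin p => muLaw ε τ).prod (noiseLaw n p) := measurePreserving_snd.map_eq
  have hfst : (jointLaw n p ε τ).map Prod.fst = Measure.pi fun _ : Fin n => signLaw :=
    measurePreserving_fst.map_eq
  have hmu : (jointLaw n p ε τ).map (fun ω => ω.2.1) =
      Measure.pi fun _ : Fin p => muLaw ε τ := by
    change (jointLaw n p ε τ).map (Prod.fst ∘ Prod.snd) = _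
    rw [← Measure.map_map measurable_fst measurable_snd, hsnd]
    exact measurePreserving_fst.map_eq
  have hZ : (jointLaw n p ε τ).map (fun ω => ω.2.2) = noiseLaw n p := by
    change (jointLaw n p ε τ).map (Prod.snd ∘ Prod.snd) = _
    rw [← Measure.map_map measurable_snd measurable_snd, hsnd]
    exact measurePreserving_snd.map_eq
  have hae1 : ∀ᵐ ω ∂(jointLaw n p ε τ), ∀ i, ω.1 i = 1 ∨ ω.1 i = -1 :=
    ae_of_ae_map measurable_fst.aemeasurable (by rw [hfst]; exact ae_pi_signLaw n)
  have hae2 : ∀ᵐ ω ∂(jointLaw n p ε τ), ∀ j, ω.2.1 j = 0 ∨ ω.2.1 j = τ :=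
    ae_of_ae_map (f := fun ω : Omega n p => ω.2.1)
      (measurable_fst.comp measurable_snd).aemeasurable
      (by rw [hmu]; exact ae_pi_muLaw p τ h0 h1)
  have hle : (jointLaw n p ε τ) B ≤
      (Measure.pi fun _ : Fin p => muLaw ε τ) A + (noiseLaw n p) D := by
    calc (jointLaw n p ε τ) B ≤
        (jointLaw n p ε τ) ((fun ω => ω.2.1) ⁻¹' A ∪ (fun ω => ω.2.2) ⁻¹' D) := by
          refine measure_mono_ae ?_
          filter_upwards [hae1, hae2] with ω hω1 hω2 hB
          exact h ω hB hω1 hω2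
      _ ≤ _ := measure_union_le _ _
      _ ≤ _ := by
          gcongr
          · rw [← hmu]
            exact Measure.le_map_apply (by fun_prop) _
          · rw [← hZ]
            exact Measure.le_map_apply (by fun_prop) _
  have h2 := ENNReal.toReal_mono (by finiteness) hle
  rwa [ENNReal.toReal_add (by finiteness) (by finiteness)] at h2

lemma hammingClu_nonneg (n p : ℕ) (ε τ : ℝ) (D : Omega n p → Fin n → Fin p → ℝ)
    (ell : (Fin n → Fin p → ℝ) → Fin n → ℝ) : 0 ≤ hammingClu n p ε τ D ell := by
  unfold hammingClu
  positivity

lemma hammingClu_le {n p : ℕ} {ε τ : ℝ} {D : Omega n p → Fin n → Fin p → ℝ}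
    {ell : (Fin n → Fin p → ℝ) → Fin n → ℝ} {r : ℝ} (hn : 0 < n)
    (h : ∑ i, (jointLaw n p ε τ).real {ω | ell (D ω) i ≠ ω.1 i} ≤ n * r) :
    hammingClu n p ε τ D ell ≤ r := by
  have hn' : (0 : ℝ) < n := by exact_mod_cast hn
  unfold hammingClu
  refine (mul_le_mul_of_nonneg_left (min_le_left _ _) (by positivity)).trans ?_
  rw [inv_mul_le_iff₀ hn']
  exact h

/-- Non-asymptotic error bound for Simple Aggregation. -/
lemma hammingClu_ellSimpleAgg_le {n p : ℕ} {ε τ : ℝ} (hn : 0 < n) (hp : 0 < p) (h0 : 0 < ε)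
    (h1 : ε ≤ 1) (hτ : 0 < τ) :
    hammingClu n p ε τ dataMap ellSimpleAgg ≤
      4 / (p * ε) + 2 * Real.exp (-((p * ε * τ) ^ 2 / (8 * p))) := by
  have hp' : (0 : ℝ) < p := by exact_mod_cast hp
  refine hammingClu_le hn ?_
  refine (Finset.sum_le_card_nsmul _ _ (4 / (p * ε) +
    2 * Real.exp (-((p * ε * τ) ^ 2 / (8 * p)))) fun i _ => ?_).trans (by simp [mul_add])
  set t := p * ε * τ / 2 with ht
  have ht0 : 0 ≤ t := by positivity
  let a : Fin n → Fin p → ℝ := fun i' _ => if i' = i then 1 else 0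
  have ha : ∑ i', ∑ j, a i' j ^ 2 = p := by simp [a]
  have hsumZ : ∀ Z : Fin n → Fin p → ℝ, ∑ i', ∑ j, a i' j * Z i' j = ∑ j, Z i j := by
    intro Z
    rw [Finset.sum_eq_single i]
    · simp [a]
    · intro b _ hb; simp [a, hb]
    · simp
  have hD := measureReal_union_le (μ := noiseLaw n p) {Z | t ≤ ∑ i', ∑ j, a i' j * Z i' j}
    {Z | t ≤ ∑ i', ∑ j, (-a i' j) * Z i' j}
  have hb := jointLaw_real_le (n := n) (p := p) (τ := τ) h0.le h1
    (B := {ω | ellSimpleAgg (dataMap ω) i ≠ ω.1 i})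
    (A := {m | ∑ j, m j ≤ (1 - 1 / 2) * (p * ε * τ)})
    (D := {Z | t ≤ ∑ i', ∑ j, a i' j * Z i' j} ∪ {Z | t ≤ ∑ i', ∑ j, (-a i' j) * Z i' j}) (by
      intro ω hω hℓ hm
      by_contra! hcon
      obtain ⟨hA, hB⟩ := hcon
      simp only [Set.mem_union, Set.mem_ofPred_eq, not_or, not_le, neg_mul, hsumZ,
        Finset.sum_neg_distrib] at hA hB
      refine hω ?_
      simp only [ellSimpleAgg, dataMap, Finset.sum_add_distrib, ← Finset.mul_sum]
      refine sign_mul_add_eq (hℓ i) (abs_lt.2 ⟨?_, ?_⟩) <;> linarith [hB.1, hB.2])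
  have h2 := pi_muLaw_sum_le (δ := 1 / 2) hp h0 h1 hτ (by norm_num)
  have h3 := noiseLaw_linear_tail a ht0 hp' ha
  have h4 := noiseLaw_linear_tail (fun i' j => -a i' j) ht0 hp' (by simpa using ha)
  have e1 : t ^ 2 / (2 * p) = (p * ε * τ) ^ 2 / (8 * p) := by rw [ht]; field_simp; norm_num
  have e2 : 1 / ((1 / 2 : ℝ) ^ 2 * (p * ε)) = 4 / (p * ε) := by field_simp; norm_num
  rw [e1] at h3 h4
  rw [e2] at h2
  linarith

/-- Uniform control of the noise over all column sets of a given size and all sign vectors. -/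
lemma noiseLaw_exists_lt_le {n p N : ℕ} {t : ℝ} (hn : 0 < n) (hN : 0 < N) (ht : 0 ≤ t) :
    (noiseLaw n p).real {Z | ∃ S : Finset (Fin p), S.card = N ∧ ∃ v : Fin n → ℝ,
      (∀ i, v i = 1 ∨ v i = -1) ∧ t < ∑ i, v i * ∑ j ∈ S, Z i j} ≤
      2 ^ n * p ^ N * Real.exp (-(t ^ 2 / (2 * (n * N)))) := by
  have hV : (0 : ℝ) < n * N := by positivity
  let I : Finset (Finset (Fin p) × (Fin n → ℝ)) :=
    Finset.powersetCard N Finset.univ ×ˢ Fintype.piFinset fun _ => {1, -1}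
  let a : Finset (Fin p) × (Fin n → ℝ) → Fin n → Fin p → ℝ :=
    fun x i j => if j ∈ x.1 then x.2 i else 0
  have hsub : {Z : Fin n → Fin p → ℝ | ∃ S : Finset (Fin p), S.card = N ∧ ∃ v : Fin n → ℝ,
      (∀ i, v i = 1 ∨ v i = -1) ∧ t < ∑ i, v i * ∑ j ∈ S, Z i j} ⊆
      ⋃ x ∈ I, {Z | t ≤ ∑ i, ∑ j, a x i j * Z i j} := by
    rintro Z ⟨S, hS, v, hv, hlt⟩
    refine Set.mem_iUnion₂.2 ⟨(S, v), by simp [I, hS, hv], ?_⟩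
    simp only [a, Set.mem_ofPred_eq, ite_mul, zero_mul, Finset.sum_ite_mem, Finset.univ_inter,
      ← Finset.mul_sum]
    exact hlt.le
  have hcard : (I.card : ℝ) ≤ 2 ^ n * p ^ N := by
    have h1 : I.card ≤ 2 ^ n * p ^ N := by
      have h2 : ({1, -1} : Finset ℝ).card = 2 := Finset.card_pair (by norm_num)
      simp only [I, Finset.card_product, Finset.card_powersetCard, Finset.card_univ,
        Fintype.card_fin, Fintype.card_piFinset, Finset.prod_const, h2]
      rw [mul_comm]
      exact Nat.mul_le_mul_left _ (Nat.choose_le_pow p N)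
    exact_mod_cast h1
  refine (measureReal_mono hsub (measure_ne_top _ _)).trans ((measureReal_biUnion_finset_le _ _).trans ?_)
  refine (Finset.sum_le_card_nsmul _ _ (Real.exp (-(t ^ 2 / (2 * (n * N))))) ?_).trans ?_
  · rintro ⟨S, v⟩ hx
    simp only [I, Finset.mem_product, Finset.mem_powersetCard, Finset.subset_univ, true_and,
      Fintype.mem_piFinset, Finset.mem_insert, Finset.mem_singleton] at hx
    refine noiseLaw_linear_tail (a (S, v)) ht hV ?_
    have hv2 : ∀ i, v i ^ 2 = 1 := fun i => by rcases hx.2 i with h | h <;> simp [h]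
    simp [a, ite_pow, hv2, hx.1]
  · rw [nsmul_eq_mul]
    gcongr

/-- Almost surely, distinct column sets of equal size give distinct aggregated `ℓ¹` norms. -/
lemma jointLaw_tie_null {n p N : ℕ} {ε τ : ℝ} (hn : 0 < n) (h0 : 0 ≤ ε) (h1 : ε ≤ 1)
    {S T : Finset (Fin p)} (hS : S.card = N) (hT : T.card = N) (hST : S ≠ T) :
    jointLaw n p ε τ {ω | ∑ i, |∑ j ∈ S, dataMap ω i j| = ∑ i, |∑ j ∈ T, dataMap ω i j|} = 0 := by
  have := isProbabilityMeasure_muLaw τ h0 h1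
  obtain ⟨j₀, hjS, hjT⟩ : ∃ j, j ∈ S ∧ j ∉ T := by
    by_contra! hcon
    exact hST (Finset.eq_of_subset_of_card_le hcon (by rw [hS, hT]))
  have hmeas : MeasurableSet {ω : Omega n p |
      ∑ i, |∑ j ∈ S, dataMap ω i j| = ∑ i, |∑ j ∈ T, dataMap ω i j|} := by
    unfold dataMap
    refine measurableSet_eq_fun ?_ ?_ <;> fun_prop
  unfold jointLaw
  rw [Measure.measure_prod_null hmeas]
  refine Filter.Eventually.of_forall fun ℓ => ?_
  simp only [Pi.zero_apply]
  rw [Measure.measure_prod_null (measurable_prodMk_left hmeas)]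
  refine Filter.Eventually.of_forall fun m => ?_
  simp only [Pi.zero_apply]
  let i₀ : Fin n := ⟨0, hn⟩
  let V : Finset (Fin n → ℝ) := Fintype.piFinset fun _ => {1, -1}
  let a : (Fin n → ℝ) × (Fin n → ℝ) → Fin n → Fin p → ℝ :=
    fun x i j => (if j ∈ S then x.1 i else 0) - (if j ∈ T then x.2 i else 0)
  let c : (Fin n → ℝ) × (Fin n → ℝ) → ℝ := fun x => -∑ i, ∑ j, a x i j * (ℓ i * m j)
  refine measure_mono_null (t := ⋃ x ∈ V ×ˢ V, {Z | ∑ i, ∑ j, a x i j * Z i j = c x}) ?_ ?_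
  · intro Z hZ
    simp only [Set.mem_preimage, Set.mem_ofPred_eq, dataMap] at hZ
    let sg : Finset (Fin p) → Fin n → ℝ := fun U i =>
      if 0 ≤ ∑ j ∈ U, (ℓ i * m j + Z i j) then 1 else -1
    have hsg : ∀ U i, |∑ j ∈ U, (ℓ i * m j + Z i j)| =
        sg U i * ∑ j ∈ U, (ℓ i * m j + Z i j) := by
      intro U i
      by_cases h : 0 ≤ ∑ j ∈ U, (ℓ i * m j + Z i j)
      · simp only [sg, if_pos h, abs_of_nonneg h, one_mul]
      · simp only [sg, if_neg h, abs_of_neg (not_le.1 h), neg_mul, one_mul]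
    have hsgV : ∀ U, sg U ∈ V := by
      intro U
      simp only [V, Fintype.mem_piFinset, Finset.mem_insert, Finset.mem_singleton, sg]
      intro i
      split_ifs <;> simp
    refine Set.mem_iUnion₂.2 ⟨(sg S, sg T), Finset.mem_product.2 ⟨hsgV S, hsgV T⟩, ?_⟩
    simp only [Set.mem_ofPred_eq, c]
    rw [eq_neg_iff_add_eq_zero, ← Finset.sum_add_distrib]
    rw [← sub_eq_zero, ← Finset.sum_sub_distrib] at hZ
    rw [← hZ]
    refine Finset.sum_congr rfl fun i _ => ?_
    rw [hsg S i, hsg T i, ← Finset.sum_add_distrib, Finset.mul_sum, Finset.mul_sum]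
    simp only [a, sub_mul, ite_mul, zero_mul]
    simp only [sub_add_sub_comm, Finset.sum_sub_distrib, Finset.sum_add_distrib,
      Finset.sum_ite_mem, Finset.univ_inter, mul_add]
    ring
  · refine (measure_biUnion_null_iff (Finset.countable_toSet _)).2 fun x hx => ?_
    refine noiseLaw_linear_eq_null (i₀ := i₀) (j₀ := j₀) (a x) (c x) ?_
    have h := Finset.mem_product.1 (Finset.mem_coe.1 hx)
    have h2 := Fintype.mem_piFinset.1 h.1 i₀
    simp only [Finset.mem_insert, Finset.mem_singleton] at h2
    simp only [a, if_pos hjS, if_neg hjT, sub_zero]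
    rcases h2 with h2 | h2 <;> rw [h2] <;> norm_num

lemma measurable_real_sign : Measurable Real.sign := by
  have : Real.sign = fun r : ℝ => if r < 0 then -1 else if 0 < r then 1 else 0 := rfl
  rw [this]
  exact Measurable.ite measurableSet_Iio measurable_const
    (Measurable.ite measurableSet_Ioi measurable_const measurable_const)

/-- Non-asymptotic error bound for Sparse Aggregation. -/
lemma hammingClu_ellSparseAgg_le {n p N : ℕ} {ε τ ρ : ℝ} (hn : 0 < n) (hN : 0 < N) (hNp : N ≤ p)
    (h0 : 0 < ε) (h1 : ε ≤ 1) (hτ : 0 < τ) (hρ0 : 0 < ρ) (hρ : ρ ≤ 1 / 6)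
    (hNε : (1 - ρ) * N ≤ (1 - ρ / 2) * (p * ε))
    {S : (Fin n → Fin p → ℝ) → Finset (Fin p)} (hS : IsSparseAggMaximizer N S) :
    hammingClu n p ε τ dataMap (ellSparseAgg S) ≤
      2 * ρ + (1 / ((ρ / 2) ^ 2 * (p * ε)) +
        2 ^ n * p ^ N * Real.exp (-((ρ * (n * N * τ)) ^ 2 / (2 * (n * N))))) := by
  have hp : 0 < p := hN.trans_le hNp
  have := isProbabilityMeasure_jointLaw n p τ h0.le h1
  let norm1 : Finset (Fin p) → Omega n p → ℝ := fun T ω => ∑ i, |∑ j ∈ T, dataMap ω i j|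
  have hnorm1 : ∀ T, Measurable (norm1 T) := by
    intro T
    simp only [norm1, dataMap]
    fun_prop
  let strict : Finset (Fin p) → Set (Omega n p) := fun T =>
    {ω | ∀ U : Finset (Fin p), U.card = N → U ≠ T → norm1 U ω < norm1 T ω}
  let C : Fin n → Set (Omega n p) := fun i => {ω | ∃ T : Finset (Fin p), T.card = N ∧
    ω ∈ strict T ∧ Real.sign (∑ j ∈ T, dataMap ω i j) ≠ ω.1 i}
  have hC : ∀ i, MeasurableSet (C i) := by
    intro i
    have e : C i = ⋃ T : Finset (Fin p), ⋃ (_ : T.card = N),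
        ((⋂ U : Finset (Fin p), ⋂ (_ : U.card = N), ⋂ (_ : U ≠ T),
          {ω | norm1 U ω < norm1 T ω}) ∩
          {ω | Real.sign (∑ j ∈ T, dataMap ω i j) = ω.1 i}ᶜ) := by
      ext ω
      simp [C, strict, and_left_comm]
    rw [e]
    refine MeasurableSet.iUnion fun T => MeasurableSet.iUnion fun _ => MeasurableSet.inter
      (MeasurableSet.iInter fun U => MeasurableSet.iInter fun _ => MeasurableSet.iInter fun _ =>
        measurableSet_lt (hnorm1 U) (hnorm1 T)) (MeasurableSet.compl ?_)
    refine measurableSet_eq_fun (measurable_real_sign.comp ?_) (by fun_prop)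
    simp only [dataMap]
    fun_prop
  let tie : Set (Omega n p) := ⋃ x ∈ {x : Finset (Fin p) × Finset (Fin p) |
    x.1.card = N ∧ x.2.card = N ∧ x.1 ≠ x.2}, {ω | norm1 x.1 ω = norm1 x.2 ω}
  have htie : jointLaw n p ε τ tie = 0 :=
    (measure_biUnion_null_iff (Set.to_countable _)).2 fun x hx =>
      jointLaw_tie_null hn h0.le h1 hx.1 hx.2.1 hx.2.2
  have hBC : ∀ i, (jointLaw n p ε τ).real {ω | ellSparseAgg S (dataMap ω) i ≠ ω.1 i} ≤
      (jointLaw n p ε τ).real (C i) := by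
    intro i
    refine ENNReal.toReal_mono (measure_ne_top _ _) (measure_mono_ae ?_)
    filter_upwards [measure_eq_zero_iff_ae_notMem.1 htie] with ω hω hB
    refine ⟨S (dataMap ω), (hS _).1, fun U hU hne => ?_, hB⟩
    refine lt_of_le_of_ne ((hS (dataMap ω)).2 U hU) fun heq => hω ?_
    exact Set.mem_iUnion₂.2 ⟨(U, S (dataMap ω)), ⟨hU, (hS _).1, hne⟩, heq⟩
  set t := ρ * (n * N * τ) with ht
  let D : Set (Fin n → Fin p → ℝ) := {Z | ∃ S : Finset (Fin p), S.card = N ∧ ∃ v : Fin n → ℝ,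
      (∀ i, v i = 1 ∨ v i = -1) ∧ t < ∑ i, v i * ∑ j ∈ S, Z i j}
  let A : Set (Fin p → ℝ) := {m | ∑ j, m j ≤ (1 - ρ / 2) * (p * ε * τ)}
  let G : Set (Omega n p) := {ω | (∀ i, ω.1 i = 1 ∨ ω.1 i = -1) ∧
    (∀ j, ω.2.1 j = 0 ∨ ω.2.1 j = τ) ∧ ω.2.1 ∉ A ∧ ω.2.2 ∉ D}
  have hG : (jointLaw n p ε τ).real Gᶜ ≤ 1 / ((ρ / 2) ^ 2 * (p * ε)) +
      2 ^ n * p ^ N * Real.exp (-(t ^ 2 / (2 * (n * N)))) := by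
    refine (jointLaw_real_le (A := A) (D := D) h0.le h1 ?_).trans
      (add_le_add (pi_muLaw_sum_le hp h0 h1 hτ (by positivity))
        (noiseLaw_exists_lt_le hn hN (by positivity)))
    intro ω hω hℓ hm
    by_contra! hcon
    exact hω ⟨hℓ, hm, hcon.1, hcon.2⟩
  have hcard : ∀ ω ∈ G, ((Finset.univ.filter fun i => ω ∈ C i).card : ℝ) ≤ 2 * ρ * n := by
    rintro ω ⟨hℓ, hm, hA, hD⟩
    rcases (Finset.univ.filter fun i => ω ∈ C i).eq_empty_or_nonempty with he | ⟨i, hi⟩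
    · rw [he]
      simp only [Finset.card_empty, Nat.cast_zero]
      positivity
    obtain ⟨T, hT, hTs, -⟩ := (Finset.mem_filter.1 hi).2
    have hsub : (Finset.univ.filter fun i => ω ∈ C i) ⊆ Finset.univ.filter fun i =>
        Real.sign (∑ j ∈ T, (ω.1 i * ω.2.1 j + ω.2.2 i j)) ≠ ω.1 i := by
      intro k hk
      obtain ⟨U, hU, hUs, hUk⟩ := (Finset.mem_filter.1 hk).2
      have hUT : U = T := by
        by_contra hne
        exact lt_asymm (hTs U hU hne) (hUs T hT (Ne.symm hne))
      rw [hUT] at hUk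
      exact Finset.mem_filter.2 ⟨Finset.mem_univ k, hUk⟩
    refine le_trans (by exact_mod_cast Finset.card_le_card hsub)
      (card_misclustered_le hn hN hNp hτ hρ0 hρ hℓ hm ?_ ?_ hT ?_)
    · have h2 : (1 - ρ / 2) * (p * ε * τ) < ∑ j, ω.2.1 j := not_le.1 hA
      have h3 := mul_le_mul_of_nonneg_right hNε hτ.le
      linarith
    · intro U hU v hv
      by_contra! hlt
      exact hD ⟨U, hU, v, hv, hlt⟩
    · intro U hU
      rcases eq_or_ne U T with rfl | hne
      · exact le_rfl
      · exact (hTs U hU hne).le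
  refine hammingClu_le hn ((Finset.sum_le_sum fun i _ => hBC i).trans
    ((sum_measureReal_le_of_card_le hC (r := 2 * ρ * n) (by positivity)
      (G := G) fun ω hω => by convert hcard ω hω).trans ?_))
  nlinarith [mul_le_mul_of_nonneg_left hG (Nat.cast_nonneg (α := ℝ) n)]

lemma tendsto_natCast_rpow_atTop {a : ℝ} (ha : 0 < a) :
    Tendsto (fun p : ℕ => (p : ℝ) ^ a) atTop atTop :=
  (tendsto_rpow_atTop ha).comp tendsto_natCast_atTop_atTop

lemma tendsto_simpleAgg_bound {β α : ℝ} (hβ : β < 1) (hα : α < (1 - 2 * β) / 2) :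
    Tendsto (fun p : ℕ => 4 / ((p : ℝ) * (p : ℝ) ^ (-β)) +
      2 * Real.exp (-(((p : ℝ) * (p : ℝ) ^ (-β) * (p : ℝ) ^ (-α)) ^ 2 / (8 * p)))) atTop
      (nhds 0) := by
  have h1 : Tendsto (fun p : ℕ => 4 / (p : ℝ) ^ (1 - β) +
      2 * Real.exp (-((p : ℝ) ^ (1 - 2 * β - 2 * α) / 8))) atTop (nhds (0 + 2 * 0)) := by
    refine Tendsto.add ((tendsto_natCast_rpow_atTop (by linarith)).const_div_atTop 4)
      (Tendsto.const_mul 2 (Real.tendsto_exp_neg_atTop_nhds_zero.comp ?_))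
    exact (tendsto_natCast_rpow_atTop (by linarith)).atTop_div_const (by norm_num)
  rw [mul_zero, add_zero] at h1
  refine h1.congr' ?_
  filter_upwards [eventually_gt_atTop 0] with p hp
  have hp' : (0 : ℝ) < p := by exact_mod_cast hp
  have e1 : (p : ℝ) * (p : ℝ) ^ (-β) = (p : ℝ) ^ (1 - β) := by
    rw [sub_eq_add_neg, Real.rpow_add hp', Real.rpow_one]
  have e2 : ((p : ℝ) * (p : ℝ) ^ (-β) * (p : ℝ) ^ (-α)) ^ 2 / (8 * p) =
      (p : ℝ) ^ (1 - 2 * β - 2 * α) / 8 := by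
    have : (p : ℝ) ^ (1 - 2 * β - 2 * α) =
        ((p : ℝ) * (p : ℝ) ^ (-β) * (p : ℝ) ^ (-α)) ^ 2 / p := by
      rw [e1, ← Real.rpow_add hp', ← Real.rpow_natCast, ← Real.rpow_mul hp'.le,
        div_eq_mul_inv, ← Real.rpow_neg_one, ← Real.rpow_add hp']
      congr 1
      push_cast
      ring
    rw [this]
    field_simp
  rw [e1] at e2 ⊢
  rw [e2]

lemma tendsto_sparseAgg_bound {θ β α ρ : ℝ} (hβ1 : β < 1)
    (h1 : α < θ / 2) (h2 : α < (1 - β) / 2) (hρ : 0 < ρ) :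
    Tendsto (fun p : ℕ => 1 / ((ρ / 2) ^ 2 * ((p : ℝ) * (p : ℝ) ^ (-β))) +
      2 ^ (nDim p θ) * (p : ℝ) ^ ⌈(p : ℝ) * (p : ℝ) ^ (-β)⌉₊ *
        Real.exp (-((ρ * ((nDim p θ : ℕ) * (⌈(p : ℝ) * (p : ℝ) ^ (-β)⌉₊ : ℕ) *
          (p : ℝ) ^ (-α))) ^ 2 /
            (2 * ((nDim p θ : ℕ) * (⌈(p : ℝ) * (p : ℝ) ^ (-β)⌉₊ : ℕ)))))) atTop (nhds 0) := by
  have hε : Tendsto (fun p : ℕ => 1 / ((ρ / 2) ^ 2 * ((p : ℝ) ^ (1 - β))) +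
      Real.exp (-(ρ ^ 2 / 4 * (p : ℝ) ^ (θ - 2 * α)))) atTop (nhds (0 + 0)) := by
    refine Tendsto.add (((tendsto_natCast_rpow_atTop (by linarith)).const_mul_atTop
      (by positivity)).const_div_atTop 1) (Real.tendsto_exp_neg_atTop_nhds_zero.comp ?_)
    exact (tendsto_natCast_rpow_atTop (by linarith)).const_mul_atTop (by positivity)
  rw [add_zero] at hε
  have hlog : ∀ᶠ p : ℕ in atTop, Real.log p ≤ ρ ^ 2 / 8 * (p : ℝ) ^ (θ - 2 * α) := by
    have h := (isLittleO_log_rpow_atTop (r := θ - 2 * α) (by linarith)).comp_tendsto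
      tendsto_natCast_atTop_atTop
    filter_upwards [h.bound (c := ρ ^ 2 / 8) (by positivity)] with p hp
    simp only [Function.comp_apply, Real.norm_eq_abs] at hp
    rw [abs_of_nonneg (a := (p : ℝ) ^ (θ - 2 * α)) (by positivity)] at hp
    exact (le_abs_self _).trans hp
  have hlog2 : ∀ᶠ p : ℕ in atTop, Real.log 2 ≤ ρ ^ 2 / 8 * (p : ℝ) ^ (1 - β - 2 * α) :=
    ((tendsto_natCast_rpow_atTop (by linarith)).const_mul_atTop
      (by positivity)).eventually_ge_atTop _
  refine squeeze_zero' (Eventually.of_forall fun p => by positivity) ?_ hε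
  filter_upwards [eventually_gt_atTop 0, hlog, hlog2] with p hp hl hl2
  have hp' : (0 : ℝ) < p := by exact_mod_cast hp
  have e1 : (p : ℝ) * (p : ℝ) ^ (-β) = (p : ℝ) ^ (1 - β) := by
    rw [sub_eq_add_neg, Real.rpow_add hp', Real.rpow_one]
  rw [e1]
  gcongr
  set N := ⌈(p : ℝ) ^ (1 - β)⌉₊ with hN
  set n := nDim p θ with hn
  set τ := (p : ℝ) ^ (-α) with hτ
  have hτ2 : τ ^ 2 = (p : ℝ) ^ (-(2 * α)) := by
    rw [hτ, ← Real.rpow_natCast, ← Real.rpow_mul hp'.le]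
    congr 1
    push_cast
    ring
  have hNle : (p : ℝ) ^ (1 - β) ≤ N := Nat.le_ceil _
  have hnle : (p : ℝ) ^ θ ≤ n := Nat.le_ceil _
  have hN0 : 0 < N := Nat.ceil_pos.2 (Real.rpow_pos_of_pos hp' _)
  have hn0 : 0 < n := Nat.ceil_pos.2 (Real.rpow_pos_of_pos hp' _)
  have hN1 : (1 : ℝ) ≤ N := by exact_mod_cast hN0
  have hn1 : (1 : ℝ) ≤ n := by exact_mod_cast hn0
  have hnτ : (p : ℝ) ^ (θ - 2 * α) ≤ n * τ ^ 2 := by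
    rw [hτ2, sub_eq_add_neg, Real.rpow_add hp']
    gcongr
  have hNτ : (p : ℝ) ^ (1 - β - 2 * α) ≤ N * τ ^ 2 := by
    rw [hτ2, sub_eq_add_neg (1 - β), Real.rpow_add hp']
    gcongr
  have e2 : (2 : ℝ) ^ n * (p : ℝ) ^ N = Real.exp (n * Real.log 2 + N * Real.log p) := by
    rw [Real.exp_add, ← Real.log_pow, ← Real.log_pow, Real.exp_log (by positivity),
      Real.exp_log (by positivity)]
  rw [e2, ← Real.exp_add]
  refine Real.exp_le_exp.2 ?_
  have e3 : (ρ * (n * N * τ)) ^ 2 / (2 * (n * N)) = ρ ^ 2 / 2 * (n * N * τ ^ 2) := by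
    field_simp
  rw [e3]
  have hρ8 : (0 : ℝ) ≤ ρ ^ 2 / 8 := by positivity
  have hb1 : n * Real.log 2 ≤ n * (ρ ^ 2 / 8 * (N * τ ^ 2)) :=
    mul_le_mul_of_nonneg_left (hl2.trans (mul_le_mul_of_nonneg_left hNτ hρ8)) (by positivity)
  have hb2 : N * Real.log p ≤ N * (ρ ^ 2 / 8 * (n * τ ^ 2)) :=
    mul_le_mul_of_nonneg_left (hl.trans (mul_le_mul_of_nonneg_left hnτ hρ8)) (by positivity)
  have hb3 : (p : ℝ) ^ (θ - 2 * α) ≤ n * N * τ ^ 2 := by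
    refine hnτ.trans ?_
    have : (0 : ℝ) ≤ n * τ ^ 2 := by positivity
    nlinarith
  have hb4 := mul_le_mul_of_nonneg_left hb3 hρ8
  linarith

end ARWPaper

open ARWPaper Filter in
/-- statistical upper bound for clustering. If `α < η^clu_θ(β)` then
(i) Simple Aggregation succeeds when `0 < β < (1-θ)/2`, and (ii) Sparse Aggregation
with `N = ⌈p ε_p⌉` succeeds when `(1-θ)/2 < β < 1`. -/
theorem clustering_statistical_upper_bound
    (θ β α : ℝ) (hθ0 : 0 < θ) (hθ1 : θ < 1) (hβ0 : 0 < β) (hβ1 : β < 1)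
    (hα : 0 < α) (hmain : α < etaClu θ β) :
    (β < (1 - θ) / 2 →
      Tendsto
        (fun p : ℕ =>
          hammingClu (nDim p θ) p ((p : ℝ) ^ (-β)) ((p : ℝ) ^ (-α)) dataMap ellSimpleAgg)
        atTop (nhds 0)) ∧
    ((1 - θ) / 2 < β →
      ∀ Shat : (p : ℕ) → (Fin (nDim p θ) → Fin p → ℝ) → Finset (Fin p),
        (∀ p : ℕ, IsSparseAggMaximizer ⌈(p : ℝ) * (p : ℝ) ^ (-β)⌉₊ (Shat p)) →
        Tendsto
          (fun p : ℕ =>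
            hammingClu (nDim p θ) p ((p : ℝ) ^ (-β)) ((p : ℝ) ^ (-α)) dataMap
              (ellSparseAgg (Shat p)))
          atTop (nhds 0)) := by
  constructor
  · intro hβ
    rw [etaClu, if_pos hβ] at hmain
    refine squeeze_zero' (Eventually.of_forall fun p => hammingClu_nonneg _ _ _ _ _ _) ?_
      (tendsto_simpleAgg_bound hβ1 hmain)
    filter_upwards [eventually_gt_atTop 0] with p hp
    have hp' : (0 : ℝ) < p := by exact_mod_cast hp
    exact hammingClu_ellSimpleAgg_le (Nat.ceil_pos.2 (Real.rpow_pos_of_pos hp' _)) hp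
      (Real.rpow_pos_of_pos hp' _)
      (Real.rpow_le_one_of_one_le_of_nonpos (by exact_mod_cast hp) (by linarith))
      (Real.rpow_pos_of_pos hp' _)
  · intro hβ Shat hShat
    obtain ⟨h1, h2⟩ : α < θ / 2 ∧ α < (1 - β) / 2 := by
      rw [etaClu, if_neg (not_lt.2 hβ.le)] at hmain
      split_ifs at hmain with h <;> constructor <;> linarith
    rw [Metric.tendsto_nhds]
    intro δ hδ
    obtain ⟨ρ, hρ0, hρ, hρδ⟩ : ∃ ρ : ℝ, 0 < ρ ∧ ρ ≤ 1 / 6 ∧ 2 * ρ ≤ δ / 2 :=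
      ⟨min (1 / 6) (δ / 4), by positivity, min_le_left _ _,
        by linarith [min_le_right (1 / 6) (δ / 4)]⟩
    have hb := (tendsto_sparseAgg_bound hβ1 h1 h2 hρ0).eventually_lt_const (half_pos hδ)
    have hlarge := (tendsto_natCast_rpow_atTop (a := 1 - β) (by linarith)).eventually_ge_atTop
      (2 / ρ)
    filter_upwards [eventually_gt_atTop 0, hb, hlarge] with p hp hbp hlp
    have hp' : (0 : ℝ) < p := by exact_mod_cast hp
    have hp1 : (1 : ℝ) ≤ p := by exact_mod_cast hp
    have e1 : (p : ℝ) * (p : ℝ) ^ (-β) = (p : ℝ) ^ (1 - β) := by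
      rw [sub_eq_add_neg, Real.rpow_add hp', Real.rpow_one]
    rw [Real.dist_eq, sub_zero, abs_of_nonneg (hammingClu_nonneg _ _ _ _ _ _)]
    refine lt_of_le_of_lt (hammingClu_ellSparseAgg_le (n := nDim p θ)
      (Nat.ceil_pos.2 (Real.rpow_pos_of_pos hp' _)) (Nat.ceil_pos.2 (by positivity)) ?_
      (Real.rpow_pos_of_pos hp' _) (Real.rpow_le_one_of_one_le_of_nonpos hp1 (by linarith))
      (Real.rpow_pos_of_pos hp' _) hρ0 hρ ?_ (hShat p)) (by linarith)
    · refine Nat.ceil_le.2 ?_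
      rw [e1]
      exact (Real.rpow_le_rpow_of_exponent_le hp1 (by linarith)).trans (Real.rpow_one _).le
    · have hc := Nat.ceil_lt_add_one (a := (p : ℝ) * (p : ℝ) ^ (-β)) (by positivity)
      rw [e1] at hc ⊢
      rw [div_le_iff₀ hρ0] at hlp
      nlinarith
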